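/- Suppose that the Dai–Yuan formula β_n = β_n^DY := ‖x_{n+1} − T(x_{n+1})‖² / ⟨d_n, y_n⟩ is used and that ‖x_n − T(x_n)‖ ≠ 0 for all n ∈ ℕ. Then liminf_{n→∞} ‖x_n − T(x_n)‖ = 0. -/

import Mathlib

open RealInnerProductSpace Filter

section DaiYuan

variable {H : Type*} [NormedAddCommGroup H] [InnerProductSpace ℝ H]

lemma norm_sub_map_sub_le {E : Type*} [SeminormedAddCommGroup E]
    {T : E → E} (hT : ∀ x y : E, ‖T x - T y‖ ≤ ‖x - y‖) (x y : E) :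
    ‖(x - T x) - (y - T y)‖ ≤ 2 * ‖x - y‖ := by
  have h : (x - T x) - (y - T y) = (x - y) - (T x - T y) := by abel
  rw [h]
  linarith [norm_sub_le (x - y) (T x - T y), hT x y]

/-- The curvature condition at a descent direction makes the Dai–Yuan denominator positive. -/
lemma inner_sub_pos_of_curvature {σ : ℝ} (hσ : σ < 1) {g g' d : H} (hs : ⟪g, d⟫ < 0)
    (hW : σ * ⟪g, d⟫ ≤ ⟪g', d⟫) : 0 < ⟪d, g' - g⟫ := by
  rw [inner_sub_right, real_inner_comm g' d, real_inner_comm g d]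
  nlinarith

/-- The Dai–Yuan parameter is the ratio of consecutive directional derivatives. -/
lemma inner_daiYuan_direction {g g' d : H} (hy : 0 < ⟪d, g' - g⟫) :
    ⟪g', -g' + (‖g'‖ ^ 2 / ⟪d, g' - g⟫) • d⟫ = ‖g'‖ ^ 2 / ⟪d, g' - g⟫ * ⟪g, d⟫ := by
  have h : ⟪g', d⟫ = ⟪d, g' - g⟫ + ⟪g, d⟫ := by
    rw [inner_sub_right, real_inner_comm g' d, real_inner_comm g d]
    ring
  rw [inner_add_right, inner_neg_right, real_inner_smul_right, real_inner_self_eq_norm_sq, h]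
  field_simp
  ring

/-- The decrease forced by the Armijo and curvature conditions for a `2`-Lipschitz residual. -/
lemma zoutendijk_decrease {δ σ a : ℝ} (hδ : 0 < δ) {g g' d : H} (hs : ⟪g, d⟫ < 0)
    (hL : ‖g' - g‖ ≤ 2 * (a * ‖d‖))
    (hA : ‖g'‖ ^ 2 - ‖g‖ ^ 2 ≤ δ * a * ⟪g, d⟫) (hW : σ * ⟪g, d⟫ ≤ ⟪g', d⟫) :
    δ * (1 - σ) / 2 * (‖d‖ ^ 2 / ⟪g, d⟫ ^ 2)⁻¹ ≤ ‖g‖ ^ 2 - ‖g'‖ ^ 2 := by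
  have hd : 0 < ‖d‖ := by
    rw [norm_pos_iff]
    rintro rfl
    simp at hs
  have h₁ : (1 - σ) * -⟪g, d⟫ ≤ 2 * a * ‖d‖ ^ 2 := by
    have h := real_inner_le_norm (g' - g) d
    rw [inner_sub_left] at h
    nlinarith [mul_le_mul_of_nonneg_right hL hd.le]
  have h₂ : δ * (1 - σ) / 2 * (‖d‖ ^ 2 / ⟪g, d⟫ ^ 2)⁻¹ ≤ δ * a * -⟪g, d⟫ := by
    rw [inv_div, ← mul_div_assoc, div_le_iff₀ (by positivity)]
    have h := mul_le_mul_of_nonneg_left h₁ (mul_pos hδ (neg_pos.mpr hs)).le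
    nlinarith
  linarith

lemma norm_sq_div_inner_sq_le {b : ℝ} {g g' d d' : H} (hd : d' = -g' + b • d)
    (hs : ⟪g, d⟫ ≠ 0) (hs' : ⟪g', d'⟫ ≠ 0) (hb : ⟪g', d'⟫ = b * ⟪g, d⟫) (hg' : ‖g'‖ ≠ 0) :
    ‖d'‖ ^ 2 / ⟪g', d'⟫ ^ 2 ≤ ‖d‖ ^ 2 / ⟪g, d⟫ ^ 2 + 1 / ‖g'‖ ^ 2 := by
  have hb0 : b ≠ 0 := by
    rintro rfl
    simp [hb] at hs'
  have h : ‖d'‖ ^ 2 + 2 * ⟪g', d'⟫ + ‖g'‖ ^ 2 = b ^ 2 * ‖d‖ ^ 2 := by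
    have h := norm_add_sq_real d' g'
    rw [real_inner_comm, show d' + g' = b • d by rw [hd]; abel, norm_smul, mul_pow,
      Real.norm_eq_abs, sq_abs] at h
    linarith
  have hR : ‖d‖ ^ 2 / ⟪g, d⟫ ^ 2 = (b ^ 2 * ‖d‖ ^ 2) / ⟪g', d'⟫ ^ 2 := by
    rw [hb]
    field_simp
  have hsq : ‖d‖ ^ 2 / ⟪g, d⟫ ^ 2 + 1 / ‖g'‖ ^ 2 - ‖d'‖ ^ 2 / ⟪g', d'⟫ ^ 2
      = (1 / ‖g'‖ + ‖g'‖ / ⟪g', d'⟫) ^ 2 := by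
    rw [hR, ← h]
    field_simp
    ring
  linarith [sq_nonneg (1 / ‖g'‖ + ‖g'‖ / ⟪g', d'⟫)]

/-- A nonnegative sequence cannot decrease by a fixed multiple of the harmonic terms. -/
lemma not_forall_harmonic_decrease {f : ℕ → ℝ} (hf : ∀ n, 0 ≤ f n) {c : ℝ} (hc : 0 < c) :
    ¬ ∀ n : ℕ, c * (1 / ((n : ℝ) + 1)) ≤ f n - f (n + 1) := by
  intro h
  obtain ⟨N, hN⟩ := (Real.tendsto_sum_range_one_div_nat_succ_atTop.eventually_gt_atTop
    (f 0 / c)).exists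
  rw [div_lt_iff₀' hc, Finset.mul_sum] at hN
  have hsum := Finset.sum_le_sum fun n (_ : n ∈ Finset.range N) => h n
  rw [Finset.sum_range_sub'] at hsum
  linarith [hf N]

end DaiYuan

/-- Dai–Yuan direction: liminf ‖x n − T (x n)‖ = 0. -/
theorem stmt_6 {H : Type*} [NormedAddCommGroup H] [InnerProductSpace ℝ H] [CompleteSpace H]
    (T : H → H) (hT : ∀ x y : H, ‖T x - T y‖ ≤ ‖x - y‖) (hFix : ∃ p : H, T p = p)
    (δ σ : ℝ) (hδ : δ ∈ Set.Ioo (0:ℝ) 1) (hσ : σ ∈ Set.Ioo (0:ℝ) 1) (hδσ : δ ≤ σ)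
    (x d : ℕ → H) (α : ℕ → ℝ) (β : ℕ → ℝ) (hα : ∀ n, α n ∈ Set.Ioc (0:ℝ) 1)
    (hx : ∀ n, x (n+1) = x n + α n • d n)
    (hA : ∀ n, ‖x (n+1) - T (x (n+1))‖ ^ 2 - ‖x n - T (x n)‖ ^ 2
      ≤ δ * α n * ⟪x n - T (x n), d n⟫)
    (hW : ∀ n, σ * ⟪x n - T (x n), d n⟫ ≤ ⟪x (n+1) - T (x (n+1)), d n⟫)
    (hd0 : d 0 = -(x 0 - T (x 0)))
    (hd : ∀ n, d (n+1) = -(x (n+1) - T (x (n+1))) + β n • d n)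
    (hβ : ∀ n, β n = ‖x (n+1) - T (x (n+1))‖ ^ 2
      / ⟪d n, (x (n+1) - T (x (n+1))) - (x n - T (x n))⟫)
    (hnz : ∀ n, ‖x n - T (x n)‖ ≠ 0) :
    liminf (fun n => ‖x n - T (x n)‖) atTop = 0 := by
  obtain ⟨hδ0, -⟩ := hδ
  obtain ⟨-, hσ1⟩ := hσ
  set g : ℕ → H := fun n => x n - T (x n) with hg
  change ∀ n, ‖g (n + 1)‖ ^ 2 - ‖g n‖ ^ 2 ≤ δ * α n * ⟪g n, d n⟫ at hA
  change ∀ n, σ * ⟪g n, d n⟫ ≤ ⟪g (n + 1), d n⟫ at hW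
  change d 0 = -g 0 at hd0
  change ∀ n, d (n + 1) = -g (n + 1) + β n • d n at hd
  change ∀ n, β n = ‖g (n + 1)‖ ^ 2 / ⟪d n, g (n + 1) - g n⟫ at hβ
  change ∀ n, ‖g n‖ ≠ 0 at hnz
  change liminf (fun n => ‖g n‖) atTop = 0
  have hpos : ∀ n, 0 < ‖g n‖ := fun n => (norm_nonneg _).lt_of_ne' (hnz n)
  have hratio : ∀ n, ⟪g n, d n⟫ < 0 → ⟪g (n + 1), d (n + 1)⟫ = β n * ⟪g n, d n⟫ := fun n hs => by
    rw [hd, hβ]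
    exact inner_daiYuan_direction (inner_sub_pos_of_curvature hσ1 hs (hW n))
  have hdesc : ∀ n, ⟪g n, d n⟫ < 0 := by
    intro n
    induction n with
    | zero =>
      rw [hd0, inner_neg_right, real_inner_self_eq_norm_sq, neg_lt_zero]
      exact pow_pos (hpos 0) 2
    | succ n ih =>
      rw [hratio n ih, hβ]
      exact mul_neg_of_pos_of_neg
        (div_pos (pow_pos (hpos _) 2) (inner_sub_pos_of_curvature hσ1 ih (hW n))) ih
  have hanti : Antitone fun n => ‖g n‖ := by
    refine antitone_nat_of_succ_le fun n => ?_
    have h := mul_neg_of_pos_of_neg (mul_pos hδ0 (hα n).1) (hdesc n)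
    exact (sq_le_sq₀ (norm_nonneg _) (norm_nonneg _)).mp (by linarith [hA n])
  have hdecr : ∀ n, δ * (1 - σ) / 2 * (‖d n‖ ^ 2 / ⟪g n, d n⟫ ^ 2)⁻¹
      ≤ ‖g n‖ ^ 2 - ‖g (n + 1)‖ ^ 2 := by
    refine fun n => zoutendijk_decrease hδ0 (hdesc n) ?_ (hA n) (hW n)
    have h := norm_sub_map_sub_le hT (x (n + 1)) (x n)
    rwa [show x (n + 1) - x n = α n • d n by rw [hx]; abel, norm_smul,
      Real.norm_of_nonneg (hα n).1.le] at h
  have hsmall : ∀ ε > 0, ∃ n, ‖g n‖ < ε := by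
    intro ε hε
    by_contra! hge
    have hinv : ∀ n, 1 / ‖g n‖ ^ 2 ≤ 1 / ε ^ 2 := fun n =>
      one_div_le_one_div_of_le (by positivity) (pow_le_pow_left₀ hε.le (hge n) 2)
    have hgrow : ∀ n : ℕ, ‖d n‖ ^ 2 / ⟪g n, d n⟫ ^ 2 ≤ ((n : ℝ) + 1) * (1 / ε ^ 2) := by
      intro n
      induction n with
      | zero =>
        have h : ‖d 0‖ ^ 2 / ⟪g 0, d 0⟫ ^ 2 = 1 / ‖g 0‖ ^ 2 := by
          rw [hd0, inner_neg_right, real_inner_self_eq_norm_sq, norm_neg]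
          have := hnz 0
          field_simp
        rw [h]
        simpa using hinv 0
      | succ n ih =>
        have h := norm_sq_div_inner_sq_le (hd n) (hdesc n).ne (hdesc (n + 1)).ne
          (hratio n (hdesc n)) (hnz (n + 1))
        push_cast
        linarith [hinv (n + 1)]
    have hc : 0 < δ * (1 - σ) / 2 := by
      have := sub_pos.mpr hσ1
      positivity
    refine not_forall_harmonic_decrease (f := fun n => ‖g n‖ ^ 2) (fun n => by positivity)
      (c := δ * (1 - σ) / 2 * ε ^ 2) (by positivity) fun n => ?_
    refine le_trans ?_ (hdecr n)
    have hdn : 0 < ‖d n‖ := norm_pos_iff.mpr fun h => by simpa [h] using hdesc n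
    have hR : 0 < ‖d n‖ ^ 2 / ⟪g n, d n⟫ ^ 2 := div_pos (pow_pos hdn 2) (sq_pos_of_neg (hdesc n))
    rw [mul_assoc]
    refine mul_le_mul_of_nonneg_left ?_ hc.le
    calc ε ^ 2 * (1 / ((n : ℝ) + 1)) = (((n : ℝ) + 1) * (1 / ε ^ 2))⁻¹ := by
          field_simp
      _ ≤ _ := inv_anti₀ hR (hgrow n)
  refine Tendsto.liminf_eq (Metric.tendsto_atTop.mpr fun ε hε => ?_)
  obtain ⟨N, hN⟩ := hsmall ε hε
  refine ⟨N, fun n hn => ?_⟩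
  rw [dist_zero_right, norm_norm]
  exact (hanti hn).trans_lt hN
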